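/- Let K ∈ ℝ, c > 0, and T > 0, with T ≤ π·K^{-1/2} in the case K > 0. Let φ : [0,T] → ℝ be twice differentiable with φ(0) = 0, φ'(0) = c, and φ''(s) + K·φ(s) ≥ 0 for all s ∈ [0,T]. Then φ(s) ≥ c·Φ_K(s) for all s ∈ [0,T]; in particular, φ(s) > 0 for all s ∈ (0,T). -/

import Mathlib

/-- The comparison function `Φ_K`. -/
noncomputable def PhiComp (K t : ℝ) : ℝ :=
  if K < 0 then Real.sinh (Real.sqrt |K| * t) / Real.sqrt |K|
  else if K = 0 then t
  else Real.sin (Real.sqrt K * t) / Real.sqrt K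

theorem PhiComp_zero (K : ℝ) : PhiComp K 0 = 0 := by
  simp [PhiComp]

theorem PhiComp_pos {K T t : ℝ} (hTK : 0 < K → T ≤ Real.pi / Real.sqrt K)
    (ht : t ∈ Set.Ioo 0 T) : 0 < PhiComp K t := by
  obtain ⟨ht0, htT⟩ := ht
  rcases lt_trichotomy K 0 with hK | rfl | hK
  · have hr : 0 < Real.sqrt |K| := Real.sqrt_pos.2 (abs_pos.2 hK.ne)
    rw [PhiComp, if_pos hK]
    exact div_pos (Real.sinh_pos_iff.2 (mul_pos hr ht0)) hr
  · simpa [PhiComp] using ht0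
  · have hr : 0 < Real.sqrt K := Real.sqrt_pos.2 hK
    rw [PhiComp, if_neg hK.le.not_gt, if_neg hK.ne']
    refine div_pos (Real.sin_pos_of_pos_of_lt_pi (mul_pos hr ht0) ?_) hr
    rw [mul_comm, ← lt_div_iff₀ hr]
    exact htT.trans_le (hTK hK)

/-- `PhiComp K` solves `y'' + K y = 0`, `y'(0) = 1`. -/
theorem exists_hasDerivAt_PhiComp (K : ℝ) : ∃ C : ℝ → ℝ, C 0 = 1 ∧
    (∀ t, HasDerivAt (PhiComp K) (C t) t) ∧ ∀ t, HasDerivAt C (-K * PhiComp K t) t := by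
  rcases lt_trichotomy K 0 with hK | rfl | hK
  · have hr : 0 < Real.sqrt |K| := Real.sqrt_pos.2 (abs_pos.2 hK.ne)
    have hsq : Real.sqrt |K| ^ 2 = -K := by rw [Real.sq_sqrt (abs_nonneg K), abs_of_neg hK]
    have hPhi : PhiComp K = fun t => Real.sinh (Real.sqrt |K| * t) / Real.sqrt |K| := by
      ext t; rw [PhiComp, if_pos hK]
    rw [hPhi]
    generalize Real.sqrt |K| = r at *
    refine ⟨fun t => Real.cosh (r * t), by simp, fun t => ?_, fun t => ?_⟩
    · refine ((((hasDerivAt_id t).const_mul r).sinh).div_const r).congr_deriv ?_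
      simp only [id]; field_simp
    · refine (((hasDerivAt_id t).const_mul r).cosh).congr_deriv ?_
      simp only [id]; rw [← hsq]; field_simp
  · have hPhi : PhiComp 0 = fun t => t := by ext t; simp [PhiComp]
    rw [hPhi]
    refine ⟨fun _ => 1, rfl, fun t => hasDerivAt_id t, fun t => ?_⟩
    simpa using hasDerivAt_const t (1 : ℝ)
  · have hr : 0 < Real.sqrt K := Real.sqrt_pos.2 hK
    have hsq : Real.sqrt K ^ 2 = K := Real.sq_sqrt hK.le
    have hPhi : PhiComp K = fun t => Real.sin (Real.sqrt K * t) / Real.sqrt K := by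
      ext t; rw [PhiComp, if_neg hK.le.not_gt, if_neg hK.ne']
    rw [hPhi]
    generalize Real.sqrt K = r at *
    refine ⟨fun t => Real.cos (r * t), by simp, fun t => ?_, fun t => ?_⟩
    · refine ((((hasDerivAt_id t).const_mul r).sin).div_const r).congr_deriv ?_
      simp only [id]; field_simp
    · refine (((hasDerivAt_id t).const_mul r).cos).congr_deriv ?_
      simp only [id]; rw [← hsq]; field_simp

theorem scalar_comparison_estimate (K c T : ℝ) (hc : 0 < c) (hT : 0 < T)
    (hTK : 0 < K → T ≤ Real.pi / Real.sqrt K) (φ : ℝ → ℝ)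
    (hφ : ∀ s ∈ Set.Icc 0 T, DifferentiableWithinAt ℝ φ (Set.Icc 0 T) s)
    (hφ' : ∀ s ∈ Set.Icc 0 T,
      DifferentiableWithinAt ℝ (derivWithin φ (Set.Icc 0 T)) (Set.Icc 0 T) s)
    (h0 : φ 0 = 0) (h0' : derivWithin φ (Set.Icc 0 T) 0 = c)
    (hineq : ∀ s ∈ Set.Icc 0 T,
      derivWithin (derivWithin φ (Set.Icc 0 T)) (Set.Icc 0 T) s + K * φ s ≥ 0) :
    (∀ s ∈ Set.Icc 0 T, φ s ≥ c * PhiComp K s) ∧ ∀ s ∈ Set.Ioo 0 T, 0 < φ s := by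
  obtain ⟨C, hC0, hS, hC⟩ := exists_hasDerivAt_PhiComp K
  have key : ∀ s ∈ Set.Icc 0 T, φ s ≥ c * PhiComp K s := by
    intro s hs
    set ψ := derivWithin φ (Set.Icc 0 T) with hψ
    -- By variation of parameters, `G` is nondecreasing from `c * PhiComp K s` to `φ s`.
    let G : ℝ → ℝ := fun t => ψ t * PhiComp K (s - t) + φ t * C (s - t)
    have hsub : Set.Icc 0 s ⊆ Set.Icc 0 T := Set.Icc_subset_Icc_right hs.2
    have hG : ∀ t ∈ Set.Icc 0 s, HasDerivWithinAt G
        ((derivWithin ψ (Set.Icc 0 T) t + K * φ t) * PhiComp K (s - t)) (Set.Icc 0 T) t := by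
      intro t ht
      have h1 := (hφ t (hsub ht)).hasDerivWithinAt
      have h2 := (hφ' t (hsub ht)).hasDerivWithinAt
      have h3 := ((hS (s - t)).comp_const_sub s t).hasDerivWithinAt (s := Set.Icc 0 T)
      have h4 := ((hC (s - t)).comp_const_sub s t).hasDerivWithinAt (s := Set.Icc 0 T)
      refine ((h2.mul h3).add (h1.mul h4)).congr_deriv ?_
      rw [← hψ]
      ring
    have hmono : MonotoneOn G (Set.Icc 0 s) := by
      refine monotoneOn_of_hasDerivWithinAt_nonneg (convex_Icc 0 s)
        (fun t ht => ((hG t ht).mono hsub).continuousWithinAt)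
        (fun t ht => (hG t (interior_subset ht)).mono (interior_subset.trans hsub)) ?_
      intro t ht
      rw [interior_Icc] at ht
      exact mul_nonneg (hineq t (hsub (Set.Ioo_subset_Icc_self ht)))
        (PhiComp_pos hTK ⟨sub_pos.2 ht.2, by linarith [ht.1, hs.2]⟩).le
    have hle := hmono (Set.left_mem_Icc.2 hs.1) (Set.right_mem_Icc.2 hs.1) hs.1
    simpa [G, h0, h0', hC0, PhiComp_zero] using hle
  exact ⟨key, fun s hs => (mul_pos hc (PhiComp_pos hTK hs)).trans_le
    (key s (Set.Ioo_subset_Icc_self hs))⟩
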